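/- Let G be a connected decomposable claw-free graph with maximum degree 3 such that χ'_irr(G) > 3 and every decomposable claw-free graph with maximum degree at most 3 and fewer edges than G has locally irregular chromatic index at most 3. Then G contains no two adjacent vertices that both have degree 2 in G. -/

import Mathlib

/-- A graph is *locally irregular* if no two adjacent vertices have the same degree. -/
def LocallyIrregular {V : Type*} (G : SimpleGraph V) : Prop :=
  ∀ ⦃u v : V⦄, G.Adj u v → (G.neighborSet u).ncard ≠ (G.neighborSet v).ncard

/-- `HasLIEC G k` : `G` admits a locally irregular edge-coloring using at most `k` colors,
i.e. an assignment of one of `k` colors to every edge such that the edges of each fixed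
color induce a locally irregular graph. -/
def HasLIEC {V : Type*} (G : SimpleGraph V) (k : ℕ) : Prop :=
  ∃ c : Sym2 V → Fin k, ∀ i : Fin k,
    LocallyIrregular (SimpleGraph.fromEdgeSet {e | e ∈ G.edgeSet ∧ c e = i})

/-- A graph is *decomposable* if it admits a locally irregular edge-coloring. -/
def Decomposable {V : Type*} (G : SimpleGraph V) : Prop :=
  ∃ k : ℕ, HasLIEC G k

/-- A graph is *claw-free* if it contains no induced subgraph isomorphic to `K_{1,3}`. -/
def ClawFree {V : Type*} (G : SimpleGraph V) : Prop :=
  ¬ ∃ v a b c : V, a ≠ b ∧ a ≠ c ∧ b ≠ c ∧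
      G.Adj v a ∧ G.Adj v b ∧ G.Adj v c ∧ ¬ G.Adj a b ∧ ¬ G.Adj a c ∧ ¬ G.Adj b c

/-- `G` has maximum degree at most `d`. -/
def MaxDegreeLE {V : Type*} (G : SimpleGraph V) (d : ℕ) : Prop :=
  ∀ v : V, (G.neighborSet v).ncard ≤ d

open Classical in
theorem addPiece {V : Type*} {k : ℕ} (G' H K : SimpleGraph V) (c : Sym2 V → Fin k) (i : Fin k)
    (hc : ∀ j, LocallyIrregular (SimpleGraph.fromEdgeSet {e | e ∈ H.edgeSet ∧ c e = j}))
    (hK : LocallyIrregular K)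
    (hG : ∀ a b, G'.Adj a b ↔ H.Adj a b ∨ K.Adj a b)
    (hdis : ∀ a b, K.Adj a b → ¬ H.Adj a b)
    (hd : ∀ p q r, K.Adj p q → H.Adj p r → c s(p, r) ≠ i) :
    ∃ c' : Sym2 V → Fin k,
      (∀ j, LocallyIrregular (SimpleGraph.fromEdgeSet {e | e ∈ G'.edgeSet ∧ c' e = j})) ∧
      (∀ a b, K.Adj a b → c' s(a, b) = i) ∧ (∀ a b, ¬ K.Adj a b → c' s(a, b) = c s(a, b)) := by
  refine ⟨fun e => if e ∈ K.edgeSet then i else c e, ?_, ?_, ?_⟩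
  rotate_left
  · intro a b h; simp [h]
  · intro a b h; simp [h]
  intro j u v huv
  have key : ∀ p, (∃ q, K.Adj p q) → i = j →
      (SimpleGraph.fromEdgeSet {e | e ∈ G'.edgeSet ∧ (if e ∈ K.edgeSet then i else c e) = j}).neighborSet p
        = K.neighborSet p := by
    rintro p ⟨q, hq⟩ rfl
    ext r
    have := hd p q r hq
    have h2 := hG p r
    have h3 := fun h : K.Adj p r => h.ne
    simp only [SimpleGraph.mem_neighborSet, SimpleGraph.fromEdgeSet_adj, Set.mem_ofPred_eq,
      SimpleGraph.mem_edgeSet]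
    grind
  have key2 : ∀ p, (i = j → ¬ ∃ q, K.Adj p q) →
      (SimpleGraph.fromEdgeSet {e | e ∈ G'.edgeSet ∧ (if e ∈ K.edgeSet then i else c e) = j}).neighborSet p
        = (SimpleGraph.fromEdgeSet {e | e ∈ H.edgeSet ∧ c e = j}).neighborSet p := by
    intro p hp
    ext r
    have h2 := hG p r
    have h4 := hdis p r
    clear key huv hc hK hd hG hdis
    simp only [SimpleGraph.mem_neighborSet, SimpleGraph.fromEdgeSet_adj, Set.mem_ofPred_eq,
      SimpleGraph.mem_edgeSet]
    grind
  have huv' := huv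
  simp only [SimpleGraph.fromEdgeSet_adj, Set.mem_ofPred_eq, SimpleGraph.mem_edgeSet] at huv'
  by_cases hij : i = j
  · by_cases hk : K.Adj u v
    · rw [key u ⟨v, hk⟩ hij, key v ⟨u, hk.symm⟩ hij]
      exact hK hk
    · have hH : H.Adj u v := by grind
      have e1 : c s(u, v) = j := by grind
      have e2 : c s(v, u) = j := by rw [Sym2.eq_swap]; exact e1
      rw [key2 u, key2 v]
      · apply hc j
        simp [hH, e1, hH.ne]
      · rintro - ⟨q, hq⟩; exact hd v q u hq hH.symm (e2.trans hij.symm)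
      · rintro - ⟨q, hq⟩; exact hd u q v hq hH (e1.trans hij.symm)
  · rw [key2 u (by simp [hij]), key2 v (by simp [hij])]
    apply hc j
    simp only [SimpleGraph.fromEdgeSet_adj, Set.mem_ofPred_eq, SimpleGraph.mem_edgeSet]
    grind

def cherry {V : Type*} (p q r : V) : SimpleGraph V := SimpleGraph.fromEdgeSet {s(p, q), s(p, r)}

theorem cherry_adj {V : Type*} (p q r a b : V) (h1 : p ≠ q) (h2 : p ≠ r) :
    (cherry p q r).Adj a b ↔ (a = p ∧ (b = q ∨ b = r)) ∨ (b = p ∧ (a = q ∨ a = r)) := by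
  simp only [cherry, SimpleGraph.fromEdgeSet_adj, Set.mem_insert_iff, Set.mem_singleton_iff,
    Sym2.eq_iff]
  grind

theorem cherry_irr {V : Type*} (p q r : V) (h1 : p ≠ q) (h2 : p ≠ r) (h3 : q ≠ r) :
    LocallyIrregular (cherry p q r) := by
  have hp : ((cherry p q r).neighborSet p).ncard = 2 := by
    rw [← Set.ncard_pair h3]; congr 1; ext x
    simp only [SimpleGraph.mem_neighborSet, cherry_adj p q r _ _ h1 h2]; grind
  have hq : ∀ x, x = q ∨ x = r → ((cherry p q r).neighborSet x).ncard = 1 := by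
    intro x hx
    rw [← Set.ncard_singleton p]; congr 1; ext y
    simp only [SimpleGraph.mem_neighborSet, cherry_adj p q r _ _ h1 h2]; grind
  intro u v huv
  rw [cherry_adj p q r _ _ h1 h2] at huv
  rcases huv with ⟨rfl, h⟩ | ⟨rfl, h⟩
  · rw [hp, hq _ h]; decide
  · rw [hp, hq _ h]; decide

structure GoodO {V : Type*} (G : SimpleGraph V) (O : V → V → Prop) : Prop where
  adj : ∀ a b, O a b → G.Adj a b
  tot : ∀ a b, G.Adj a b → O a b ∨ O b a
  asymm : ∀ a b, O a b → ¬ O b a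
  two : ∀ a b, O a b → ∃ a', a' ≠ a ∧ O a' b

open Classical in
theorem GoodO.dec {V : Type*} [Fintype V] [Nonempty V] {G : SimpleGraph V} {O : V → V → Prop}
    (h : GoodO G O) : Decomposable G := by
  let e := Fintype.equivFin V
  let ctr : Sym2 V → V := fun s => if h : ∃ p q, s = s(q, p) ∧ O q p then h.choose else Classical.arbitrary V
  have hctr : ∀ a b, O a b → ctr s(a, b) = b := by
    intro a b hab
    have hex : ∃ p q, s(a, b) = s(q, p) ∧ O q p := ⟨b, a, rfl, hab⟩
    have : ctr s(a, b) = hex.choose := by simp only [ctr]; rw [dif_pos hex]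
    rw [this]
    obtain ⟨q, hq, hO⟩ := hex.choose_spec
    rw [Sym2.eq_iff] at hq
    rcases hq with ⟨_, h2⟩ | ⟨h1, h2⟩
    · exact h2.symm
    · exfalso
      rw [← h1, ← h2] at hO
      exact h.asymm _ _ hab hO
  refine ⟨Fintype.card V, fun s => e (ctr s), ?_⟩
  intro i
  have hadj : ∀ a b, (SimpleGraph.fromEdgeSet {s | s ∈ G.edgeSet ∧ e (ctr s) = i}).Adj a b ↔
      (O a b ∧ b = e.symm i) ∨ (O b a ∧ a = e.symm i) := by
    intro a b
    simp only [SimpleGraph.fromEdgeSet_adj, Set.mem_ofPred_eq, SimpleGraph.mem_edgeSet]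
    constructor
    · rintro ⟨⟨h1, h2⟩, h3⟩
      rcases h.tot a b h1 with h4 | h4
      · left; rw [hctr _ _ h4] at h2; exact ⟨h4, by rw [← h2]; simp⟩
      · right; rw [Sym2.eq_swap, hctr _ _ h4] at h2; exact ⟨h4, by rw [← h2]; simp⟩
    · rintro (⟨h1, h2⟩ | ⟨h1, h2⟩)
      · refine ⟨⟨h.adj _ _ h1, ?_⟩, (h.adj _ _ h1).ne⟩
        rw [hctr _ _ h1, h2]; simp
      · refine ⟨⟨(h.adj _ _ h1).symm, ?_⟩, (h.adj _ _ h1).ne'⟩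
        rw [Sym2.eq_swap, hctr _ _ h1, h2]; simp
  have main : ∀ a b, O a b → b = e.symm i →
      ((SimpleGraph.fromEdgeSet {s | s ∈ G.edgeSet ∧ e (ctr s) = i}).neighborSet a).ncard <
      ((SimpleGraph.fromEdgeSet {s | s ∈ G.edgeSet ∧ e (ctr s) = i}).neighborSet b).ncard := by
    intro a b hab hb
    have hne := (h.adj _ _ hab).ne
    have h1 : ((SimpleGraph.fromEdgeSet {s | s ∈ G.edgeSet ∧ e (ctr s) = i}).neighborSet a).ncard ≤ 1 := by
      rw [← Set.ncard_singleton b]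
      apply Set.ncard_le_ncard _ (Set.toFinite _)
      intro r
      simp only [SimpleGraph.mem_neighborSet, hadj]
      grind
    obtain ⟨a', ha', hO⟩ := h.two a b hab
    have h2 : 1 < ((SimpleGraph.fromEdgeSet {s | s ∈ G.edgeSet ∧ e (ctr s) = i}).neighborSet b).ncard := by
      rw [Set.one_lt_ncard (Set.toFinite _)]
      refine ⟨a, ?_, a', ?_, ha'.symm⟩ <;> simp only [SimpleGraph.mem_neighborSet, hadj] <;> grind
    omega
  intro a b hab
  rw [hadj] at hab
  rcases hab with ⟨h1, h2⟩ | ⟨h1, h2⟩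
  · exact (main a b h1 h2).ne
  · exact (main b a h1 h2).ne'

theorem locIrr_comap {V W : Type*} (e : V ≃ W) (G : SimpleGraph V) (H : SimpleGraph W)
    (h : ∀ a b, G.Adj a b ↔ H.Adj (e a) (e b)) (hH : LocallyIrregular H) : LocallyIrregular G := by
  have key : ∀ a, (G.neighborSet a).ncard = (H.neighborSet (e a)).ncard := by
    intro a
    rw [← Set.ncard_image_of_injective _ e.injective]
    congr 1
    ext w
    simp only [Set.mem_image, SimpleGraph.mem_neighborSet, h]
    constructor
    · rintro ⟨x, hx, rfl⟩; exact hx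
    · intro hw; exact ⟨e.symm w, by simpa using hw, by simp⟩
  intro u v huv
  rw [key, key]
  exact hH ((h u v).1 huv)

theorem liec_comap {V W : Type*} (e : V ≃ W) (G : SimpleGraph V) (H : SimpleGraph W)
    (h : ∀ a b, G.Adj a b ↔ H.Adj (e a) (e b)) {k : ℕ} (hH : HasLIEC H k) : HasLIEC G k := by
  obtain ⟨c, hc⟩ := hH
  refine ⟨fun s => c (s.map e), fun i => ?_⟩
  refine locIrr_comap e _ _ ?_ (hc i)
  intro a b
  simp [h]

def del {V : Type*} (G : SimpleGraph V) (S : Set V) : SimpleGraph V where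
  Adj a b := G.Adj a b ∧ a ∉ S ∧ b ∉ S
  symm := ⟨fun a b h => ⟨h.1.symm, h.2.2, h.2.1⟩⟩
  loopless := ⟨fun a h => h.1.ne rfl⟩

theorem del_adj {V : Type*} (G : SimpleGraph V) (S : Set V) (a b : V) :
  (del G S).Adj a b ↔ G.Adj a b ∧ a ∉ S ∧ b ∉ S := Iff.rfl

theorem del_liec {V : Type*} [Fintype V] (G : SimpleGraph V)
    (hclaw : ClawFree G)
    (hdeg : MaxDegreeLE G 3)
    (hmin : ∀ (W : Type) [Fintype W] (H : SimpleGraph W),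
      Decomposable H → ClawFree H → MaxDegreeLE H 3 →
      H.edgeSet.ncard < G.edgeSet.ncard → HasLIEC H 3) (S : Set V) (p q : V) (hpq : G.Adj p q)
      (hp : p ∈ S) (O : V → V → Prop) (hO : GoodO (del G S) O) : HasLIEC (del G S) 3 := by
  have : Nonempty V := ⟨p⟩
  let e := Fintype.equivFin V
  let H := (del G S).comap e.symm
  have hH : ∀ a b, H.Adj a b ↔ (del G S).Adj (e.symm a) (e.symm b) := fun _ _ => Iff.rfl
  have hH' : ∀ a b, (del G S).Adj a b ↔ H.Adj (e a) (e b) := fun _ _ => by simp [hH]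
  apply liec_comap e _ H hH'
  apply hmin
  · obtain ⟨k, hk⟩ := hO.dec
    exact ⟨k, liec_comap e.symm _ _ hH hk⟩
  · rintro ⟨v, a, b, c, h1, h2, h3, h4, h5, h6, h7, h8, h9⟩
    simp only [hH, del_adj] at *
    apply hclaw
    exact ⟨e.symm v, e.symm a, e.symm b, e.symm c, by simpa, by simpa, by simpa, h4.1, h5.1, h6.1,
      by tauto, by tauto, by tauto⟩
  · intro v
    refine le_trans ?_ (hdeg (e.symm v))
    rw [← Set.ncard_image_of_injective _ e.symm.injective]
    apply Set.ncard_le_ncard _ (Set.toFinite _)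
    rintro _ ⟨x, hx, rfl⟩
    exact hx.1
  · rw [← Set.ncard_image_of_injective _ (Sym2.map.injective e.symm.injective)]
    apply Set.ncard_lt_ncard _ (Set.toFinite _)
    rw [Set.ssubset_iff_exists]
    refine ⟨?_, s(p, q), hpq, ?_⟩
    · rintro _ ⟨x, hx, rfl⟩
      induction x with | _ a b => exact hx.1
    · rintro ⟨x, hx, h⟩
      induction x with | _ a b =>
      have hx := (hH a b).1 hx
      simp only [Sym2.map_mk, Sym2.eq_iff, del_adj] at h hx
      grind

theorem exists_ne_of_two_le {V : Type*} [Finite V] {s : Set V} (a : V) (h : 2 ≤ s.ncard) :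
    ∃ b ∈ s, b ≠ a := by
  obtain ⟨x, hx, y, hy, hxy⟩ := (Set.one_lt_ncard (Set.toFinite s)).1 h
  by_cases hxa : x = a
  · exact ⟨y, hy, fun h => hxy (hxa.trans h.symm)⟩
  · exact ⟨x, hx, hxa⟩

theorem exists_good {V : Type*} [Fintype V] (G : SimpleGraph V) (hdec : Decomposable G)
    (hclaw : ClawFree G) (hdeg : MaxDegreeLE G 3) : ∃ O, GoodO G O := by
  obtain ⟨k, c, hc⟩ := hdec
  let C : Fin k → V → V → Prop := fun i a b => G.Adj a b ∧ c s(a, b) = i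
  let d : Fin k → V → ℕ := fun i a => {b | C i a b}.ncard
  have Csymm : ∀ i a b, C i a b → C i b a := by
    rintro i a b ⟨h1, h2⟩; exact ⟨h1.symm, by rw [Sym2.eq_swap]; exact h2⟩
  have Cuniq : ∀ i j a b, C i a b → C j a b → i = j := by
    rintro i j a b ⟨h1, h2⟩ ⟨_, h3⟩; exact h2.symm.trans h3
  have hne : ∀ i a b, C i a b → d i a ≠ d i b := by
    intro i a b h
    have hn : ∀ a, (SimpleGraph.fromEdgeSet {e | e ∈ G.edgeSet ∧ c e = i}).neighborSet a
        = {b | C i a b} := by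
      intro a; ext b
      have := fun h : G.Adj a b => h.ne
      simp only [SimpleGraph.mem_neighborSet, SimpleGraph.fromEdgeSet_adj, Set.mem_ofPred_eq,
        SimpleGraph.mem_edgeSet, C]
      tauto
    have := hc i (u := a) (v := b) (by simpa [h.1.ne] using h)
    rwa [hn, hn] at this
  have hle : ∀ i a, d i a ≤ 3 := by
    intro i a
    refine le_trans (Set.ncard_le_ncard ?_ (Set.toFinite _)) (hdeg a)
    intro b hb; exact hb.1
  have hpos : ∀ i a b, C i a b → 1 ≤ d i a := by
    intro i a b h
    exact (Set.ncard_pos (Set.toFinite _)).2 ⟨b, h⟩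
  have h2le : ∀ i a b b', C i a b → C i a b' → b ≠ b' → 2 ≤ d i a := by
    intro i a b b' h h' hbb
    exact (Set.one_lt_ncard (Set.toFinite _)).2 ⟨b, h, b', h', hbb⟩
  have hsum : ∀ i j a, i ≠ j → d i a + d j a ≤ 3 := by
    intro i j a hij
    rw [← Set.ncard_union_eq _ (Set.toFinite _) (Set.toFinite _)]
    · refine le_trans (Set.ncard_le_ncard ?_ (Set.toFinite _)) (hdeg a)
      rintro b (hb | hb) <;> exact hb.1
    · rw [Set.disjoint_left]
      intro b h1 h2; exact hij (Cuniq _ _ _ _ h1 h2)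
  have hex : ∀ i a b, 2 ≤ d i a → ∃ b', C i a b' ∧ b' ≠ b := by
    intro i a b h
    obtain ⟨b', h1, h2⟩ := exists_ne_of_two_le b h
    exact ⟨b', h1, h2⟩
  have aux : ∀ i r p q, d i r = 3 → C i r p → C i r q → G.Adj p q → 
      ∃ p1 p2 j, C i r p1 ∧ d i p1 = 1 ∧ p2 ≠ r ∧ C j p2 p1 ∧ d j p2 = 1 ∧ d j p1 = 2 := by
    intro i r p q hr hp hq hpq
    obtain ⟨j, hj⟩ : ∃ j, C j p q := ⟨_, hpq, rfl⟩
    have a1 := hne _ _ _ hp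
    have a2 := hne _ _ _ hq
    have a3 := hne _ _ _ hj
    have b1 := hle i p
    have b2 := hle i q
    have hij : i ≠ j := by
      rintro rfl
      have := h2le i p r q (Csymm _ _ _ hp) hj hq.1.ne
      have := h2le i q r p (Csymm _ _ _ hq) (Csymm _ _ _ hj) hp.1.ne
      omega
    have c1 := hsum i j p hij
    have c2 := hsum i j q hij
    have d1 := hpos _ _ _ (Csymm _ _ _ hp)
    have d2 := hpos _ _ _ (Csymm _ _ _ hq)
    have d3 := hpos _ _ _ hj
    have d4 := hpos _ _ _ (Csymm _ _ _ hj)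
    by_cases h : d j p = 2
    · exact ⟨p, q, j, hp, by omega, hq.1.ne', Csymm _ _ _ hj, by omega, h⟩
    · exact ⟨q, p, j, hq, by omega, hp.1.ne', hj, by omega, by omega⟩
  have star : ∀ i r, d i r = 3 →
      ∃ p1 p2 j, C i r p1 ∧ d i p1 = 1 ∧ p2 ≠ r ∧ C j p2 p1 ∧ d j p2 = 1 ∧ d j p1 = 2 := by
    intro i r hr
    obtain ⟨p, q, s, hpq, hps, hqs, hS⟩ := Set.ncard_eq_three.1 hr
    have hp : C i r p := by have : p ∈ {b | C i r b} := by rw [hS]; simp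
                            exact this
    have hq : C i r q := by have : q ∈ {b | C i r b} := by rw [hS]; simp
                            exact this
    have hs : C i r s := by have : s ∈ {b | C i r b} := by rw [hS]; simp
                            exact this
    by_cases h1 : G.Adj p q
    · exact aux i r p q hr hp hq h1
    by_cases h2 : G.Adj p s
    · exact aux i r p s hr hp hs h2
    by_cases h3 : G.Adj q s
    · exact aux i r q s hr hq hs h3
    exact absurd ⟨r, p, q, s, hpq, hps, hqs, hp.1, hq.1, hs.1, h1, h2, h3⟩ hclaw
  clear aux
  let prob : Fin k → V → Prop := fun i m => d i m = 2 ∧ ∃ l, C i m l ∧ d i l = 1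
  let T : Fin k → V → V → Prop := fun i r q => ∀ p, C i r p → p ≠ q → prob i p
  let P : Fin k → V → V → Prop := fun i a b =>
    (d i a = 1 ∧ d i b = 2) ∨ (d i a = 1 ∧ d i b = 3 ∧ ¬ T i b a) ∨ (d i a = 3 ∧ d i b = 1 ∧ T i a b) ∨
    (d i a = 3 ∧ d i b = 2 ∧ prob i b) ∨ (d i a = 2 ∧ d i b = 3 ∧ ¬ prob i a)
  refine ⟨fun a b => ∃ i, C i a b ∧ P i a b, ?_, ?_, ?_, ?_⟩
  · rintro a b ⟨i, h, _⟩; exact h.1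
  · intro a b hab
    obtain ⟨i, hi⟩ : ∃ i, C i a b := ⟨_, hab, rfl⟩
    have hi' := Csymm _ _ _ hi
    have h1 := hpos _ _ _ hi
    have h2 := hpos _ _ _ hi'
    have h3 := hle i a
    have h4 := hle i b
    have h5 := hne _ _ _ hi
    suffices P i a b ∨ P i b a by
      rcases this with h | h
      · exact Or.inl ⟨i, hi, h⟩
      · exact Or.inr ⟨i, hi', h⟩
    simp only [P]
    have : (d i a = 1 ∨ d i a = 2 ∨ d i a = 3) := by omega
    have : (d i b = 1 ∨ d i b = 2 ∨ d i b = 3) := by omega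
    by_cases T i a b <;> by_cases T i b a <;> by_cases prob i a <;> by_cases prob i b <;> 
      simp only [*, true_and, and_true, not_true, not_false_iff, and_false, false_and] <;> omega
  · rintro a b ⟨i, hi, h⟩ ⟨j, hj, h'⟩
    obtain rfl := Cuniq _ _ _ _ hi (Csymm _ _ _ hj)
    simp only [P] at h h'
    rcases h with h | h | h | h | h <;> rcases h' with h' | h' | h' | h' | h' <;>
      first | omega | exact h.2.2 h'.2.2 | exact h'.2.2 h.2.2
  · rintro a b ⟨i, hi, h⟩
    have hi' := Csymm _ _ _ hi
    simp only [P] at h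
    rcases h with ⟨h1, h2⟩ | ⟨h1, h2, h3⟩ | ⟨h1, h2, h3⟩ | ⟨h1, h2, h3⟩ | ⟨h1, h2, h3⟩
    · obtain ⟨a', ha, hne'⟩ := hex i b a (by omega)
      have ha' := Csymm _ _ _ ha
      have k1 := hpos _ _ _ ha'
      have k2 := hle i a'
      have k3 := hne _ _ _ ha
      refine ⟨a', hne', i, ha', ?_⟩
      by_cases h : d i a' = 1
      · exact Or.inl ⟨h, h2⟩
      · exact Or.inr (Or.inr (Or.inr (Or.inl ⟨by omega, h2, h2, a, hi', h1⟩)))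
    · have : ∃ p, C i b p ∧ p ≠ a ∧ ¬ prob i p := by
        by_contra hcon
        apply h3
        intro p hp hpa
        by_contra hh
        exact hcon ⟨p, hp, hpa, hh⟩
      obtain ⟨p, hp, hpa, hnp⟩ := this
      have hp' := Csymm _ _ _ hp
      have k1 := hpos _ _ _ hp'
      have k2 := hle i p
      have k3 := hne _ _ _ hp
      refine ⟨p, hpa, i, hp', ?_⟩
      by_cases h : d i p = 1
      · refine Or.inr (Or.inl ⟨h, h2, fun hT => ?_⟩)
        have := (hT a hi' hpa.symm).1
        omega
      · exact Or.inr (Or.inr (Or.inr (Or.inr ⟨by omega, h2, hnp⟩)))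
    · obtain ⟨p1, p2, j, q1, q2, q3, q4, q5, q6⟩ := star i a h1
      have : p1 = b := by
        by_contra hcon
        have := (h3 p1 q1 hcon).1
        omega
      subst this
      exact ⟨p2, q3, j, q4, Or.inl ⟨q5, q6⟩⟩
    · obtain ⟨_, l, hl, hl1⟩ := h3
      refine ⟨l, ?_, i, Csymm _ _ _ hl, Or.inl ⟨hl1, h2⟩⟩
      rintro rfl; omega
    · obtain ⟨p1, p2, j, q1, q2, q3, q4, q5, q6⟩ := star i b h2
      have hpa : p1 ≠ a := by rintro rfl; omega
      exact ⟨p1, hpa, i, Csymm _ _ _ q1, Or.inr (Or.inl ⟨q2, h2, fun hT => h3 (hT a hi' hpa.symm)⟩)⟩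

theorem fin3_avoid2 (a b : Fin 3) : ∃ i, i ≠ a ∧ i ≠ b := by revert a b; decide

theorem extA {V : Type*} (G : SimpleGraph V) (u v u' t q1 q2 : V)
    (hu : ∀ r, G.Adj u r ↔ r = u' ∨ r = v) (hv : ∀ r, G.Adj v r ↔ r = u ∨ r = u')
    (hu' : ∀ r, G.Adj u' r ↔ r = u ∨ r = v ∨ r = t) (htu : t ≠ u) (htv : t ≠ v)
    (ht : ∀ r, (del G {u, u'}).Adj t r → r = q1 ∨ r = q2)
    (h : HasLIEC (del G {u, u'}) 3) : HasLIEC G 3 := by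
  obtain ⟨c, hc⟩ := h
  have n1 : u ≠ u' := ((hu u').2 (by simp)).ne
  have n2 : u ≠ v := ((hu v).2 (by simp)).ne
  have n3 : v ≠ u' := ((hv u').2 (by simp)).ne
  have n4 : u' ≠ t := ((hu' t).2 (by simp)).ne
  obtain ⟨i, hi1, hi2⟩ := fin3_avoid2 (c s(t, q1)) (c s(t, q2))
  obtain ⟨j, hj, -⟩ := fin3_avoid2 i i
  have hs := fun a b : V => @SimpleGraph.Adj.symm V G a b
  obtain ⟨c1, hc1, e1, e1'⟩ := addPiece (del G {u, u'} ⊔ cherry u' v t) _ (cherry u' v t) c i hc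
    (cherry_irr _ _ _ n3.symm n4 htv.symm) (by simp)
    (by intro a b; simp only [cherry_adj _ _ _ _ _ n3.symm n4, del_adj, Set.mem_insert_iff,
          Set.mem_singleton_iff]; grind)
    (by
      intro p q r
      have := ht r
      simp only [cherry_adj _ _ _ _ _ n3.symm n4, del_adj, Set.mem_insert_iff,
          Set.mem_singleton_iff] at *; grind)
  obtain ⟨c2, hc2, -, -⟩ := addPiece G _ (cherry u u' v) c1 j hc1
    (cherry_irr _ _ _ n1 n2 n3.symm) 
    (by intro a b; simp only [SimpleGraph.sup_adj, cherry_adj _ _ _ _ _ n3.symm n4, 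
          cherry_adj _ _ _ _ _ n1 n2, del_adj, Set.mem_insert_iff,
          Set.mem_singleton_iff]; grind)
    (by intro a b; simp only [SimpleGraph.sup_adj, cherry_adj _ _ _ _ _ n3.symm n4, 
          cherry_adj _ _ _ _ _ n1 n2, del_adj, Set.mem_insert_iff,
          Set.mem_singleton_iff]; grind)
    (by
      intro p q r
      have := e1 p r
      simp only [SimpleGraph.sup_adj, cherry_adj _ _ _ _ _ n3.symm n4, 
          cherry_adj _ _ _ _ _ n1 n2, del_adj, Set.mem_insert_iff,
          Set.mem_singleton_iff] at *; grind)
  exact ⟨c2, hc2⟩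

theorem extB0 {V : Type*} (G : SimpleGraph V) (u v u' v' q : V)
    (hu : ∀ r, G.Adj u r ↔ r = u' ∨ r = v) (hv : ∀ r, G.Adj v r → r = u ∨ r = v')
    (hu' : ∀ r, G.Adj u' r → r = u ∨ r = q) (hvu : u' ≠ v)
    (h : HasLIEC (del G {u}) 3) : HasLIEC G 3 := by
  obtain ⟨c, hc⟩ := h
  have n1 : u ≠ u' := ((hu u').2 (by simp)).ne
  have n2 : u ≠ v := ((hu v).2 (by simp)).ne
  obtain ⟨i, hi1, hi2⟩ := fin3_avoid2 (c s(v, v')) (c s(u', q))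
  have hs := fun a b : V => @SimpleGraph.Adj.symm V G a b
  obtain ⟨c2, hc2, -, -⟩ := addPiece G _ (cherry u u' v) c i hc
    (cherry_irr _ _ _ n1 n2 hvu) 
    (by intro a b; simp only [
          cherry_adj _ _ _ _ _ n1 n2, del_adj, Set.mem_insert_iff,
          Set.mem_singleton_iff]; grind)
    (by intro a b; simp only [
          cherry_adj _ _ _ _ _ n1 n2, del_adj, Set.mem_insert_iff,
          Set.mem_singleton_iff]; grind)
    (by
      intro p q r
      simp only [
          cherry_adj _ _ _ _ _ n1 n2, del_adj, Set.mem_insert_iff,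
          Set.mem_singleton_iff] at *; grind)
  exact ⟨c2, hc2⟩

theorem fin3_avoid3 (a b c : Fin 3) (h : a = b ∨ a = c ∨ b = c) : ∃ i, i ≠ a ∧ i ≠ b ∧ i ≠ c := by
  revert a b c; decide

theorem extB1 {V : Type*} (G : SimpleGraph V) (u v u' v' x y z w : V)
    (hu : ∀ r, G.Adj u r ↔ r = u' ∨ r = v) (hv : ∀ r, G.Adj v r → r = u ∨ r = v')
    (hu' : ∀ r, G.Adj u' r ↔ r = u ∨ r = x ∨ r = y) (hvu : u' ≠ v)
    (hxu : x ≠ u) (hyu : y ≠ u) (hxv : x ≠ v) (hyv : y ≠ v) (hxy : G.Adj x y)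
    (hx : ∀ r, G.Adj x r → r = u' ∨ r = y ∨ r = z)
    (hy : ∀ r, G.Adj y r → r = u' ∨ r = x ∨ r = w)
    (h : HasLIEC (del G {u, u'}) 3) : HasLIEC G 3 := by
  obtain ⟨c, hc⟩ := h
  have n1 : u ≠ u' := ((hu u').2 (by simp)).ne
  have n2 : u ≠ v := ((hu v).2 (by simp)).ne
  have n3 : u' ≠ x := ((hu' x).2 (by simp)).ne
  have n4 : u' ≠ y := ((hu' y).2 (by simp)).ne
  have n5 := hxy.ne
  have hs := fun a b : V => @SimpleGraph.Adj.symm V G a b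
  have hsw : c s(y, x) = c s(x, y) := by rw [Sym2.eq_swap]
  have hcol : c s(x, y) = c s(x, z) ∨ c s(x, y) = c s(y, w) ∨ c s(x, z) = c s(y, w) := by
    by_contra hcon
    push Not at hcon
    have := hc (c s(x, y)) (u := x) (v := y) (by 
      simp only [SimpleGraph.fromEdgeSet_adj, Set.mem_ofPred_eq, SimpleGraph.mem_edgeSet, del_adj,
        Set.mem_insert_iff, Set.mem_singleton_iff]; grind)
    apply this
    have a1 : (SimpleGraph.fromEdgeSet {e | e ∈ (del G {u, u'}).edgeSet ∧ c e = c s(x, y)}).neighborSet x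
        = {y} := by
      ext r
      simp only [SimpleGraph.mem_neighborSet, SimpleGraph.fromEdgeSet_adj, Set.mem_ofPred_eq, SimpleGraph.mem_edgeSet, del_adj,
        Set.mem_insert_iff, Set.mem_singleton_iff]; grind
    have a2 : (SimpleGraph.fromEdgeSet {e | e ∈ (del G {u, u'}).edgeSet ∧ c e = c s(x, y)}).neighborSet y
        = {x} := by
      ext r
      simp only [SimpleGraph.mem_neighborSet, SimpleGraph.fromEdgeSet_adj, Set.mem_ofPred_eq, SimpleGraph.mem_edgeSet, del_adj,
        Set.mem_insert_iff, Set.mem_singleton_iff]; grind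
    rw [a1, a2]; simp
  obtain ⟨i, hi1, hi2, hi3⟩ := fin3_avoid3 _ _ _ hcol
  obtain ⟨j, hj1, hj2⟩ := fin3_avoid2 i (c s(v, v'))
  obtain ⟨c1, hc1, e1, e1'⟩ := addPiece (del G {u, u'} ⊔ cherry u' x y) _ (cherry u' x y) c i hc
    (cherry_irr _ _ _ n3 n4 n5) (by simp)
    (by intro a b; simp only [cherry_adj _ _ _ _ _ n3 n4, del_adj, Set.mem_insert_iff,
          Set.mem_singleton_iff]; grind)
    (by
      intro p q r
      simp only [cherry_adj _ _ _ _ _ n3 n4, del_adj, Set.mem_insert_iff,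
          Set.mem_singleton_iff] at *
      have := hx r
      have := hy r
      rintro (⟨rfl, -⟩ | ⟨rfl, rfl | rfl⟩) <;> rintro ⟨k1, k2, k3⟩ <;>
        clear hs hu hu' hx hy hv hc hcol hj1 hj2 <;>
      grind)
  obtain ⟨c2, hc2, -, -⟩ := addPiece G _ (cherry u u' v) c1 j hc1
    (cherry_irr _ _ _ n1 n2 hvu) 
    (by intro a b; simp only [SimpleGraph.sup_adj, cherry_adj _ _ _ _ _ n3 n4, 
          cherry_adj _ _ _ _ _ n1 n2, del_adj, Set.mem_insert_iff,
          Set.mem_singleton_iff]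
        have := hu a
        have := hu b
        have := hu' a
        have := hu' b
        have := G.adj_comm a b
        have := G.adj_comm u b
        have := G.adj_comm u' b
        clear hs hu hu' hx hy hv hc hc1 e1 e1' hcol hi1 hi2 hi3 hj1 hj2 hsw hxy
        grind)
    (by intro a b; simp only [SimpleGraph.sup_adj, cherry_adj _ _ _ _ _ n3 n4, 
          cherry_adj _ _ _ _ _ n1 n2, del_adj, Set.mem_insert_iff,
          Set.mem_singleton_iff]; grind)
    (by
      intro p q r
      have := e1 p r
      have := e1' p r
      simp only [SimpleGraph.sup_adj, cherry_adj _ _ _ _ _ n3 n4, 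
          cherry_adj _ _ _ _ _ n1 n2, del_adj, Set.mem_insert_iff,
          Set.mem_singleton_iff] at *
      have := hv r
      clear hs hu hu' hx hy hv hc hc1 e1 e1' hcol hi1 hi2 hi3 hsw hxy
      grind)
  exact ⟨c2, hc2⟩

/-- The tree `z - x - u' - u - v` with a further leaf `y` at `u'`. -/
def tree5 {V : Type*} (u v u' x y z : V) : SimpleGraph V :=
  SimpleGraph.fromEdgeSet {s(u', u), s(u', x), s(u', y), s(u, v), s(x, z)}

theorem tree5_adj {V : Type*} (u v u' x y z : V) (hn : [u, v, u', x, y].Nodup) (h1 : z ≠ x) (a b : V) :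
    (tree5 u v u' x y z).Adj a b ↔ (a = u' ∧ (b = u ∨ b = x ∨ b = y)) ∨ (a = u ∧ (b = u' ∨ b = v)) ∨
     (a = x ∧ (b = u' ∨ b = z)) ∨ (a = y ∧ b = u') ∨ (a = v ∧ b = u) ∨ (a = z ∧ b = x) := by
  simp only [tree5, SimpleGraph.fromEdgeSet_adj, Set.mem_insert_iff, Set.mem_singleton_iff,
    Sym2.eq_iff]
  simp at hn
  grind

theorem tree5_irr {V : Type*} (u v u' x y z : V) (hn : [u, v, u', x, y, z].Nodup) :
    LocallyIrregular (tree5 u v u' x y z) := by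
  have hadj := tree5_adj u v u' x y z (by simp at hn ⊢; grind) (by simp at hn; grind)
  simp at hn
  have hp : ((tree5 u v u' x y z).neighborSet u').ncard = 3 := by
    have : (tree5 u v u' x y z).neighborSet u' = {u, x, y} := by
      ext r; simp only [SimpleGraph.mem_neighborSet, hadj]; grind
    rw [this, Set.ncard_eq_three]; exact ⟨u, x, y, by grind, by grind, by grind, rfl⟩
  have hu : ((tree5 u v u' x y z).neighborSet u).ncard = 2 := by
    have : (tree5 u v u' x y z).neighborSet u = {u', v} := by
      ext r; simp only [SimpleGraph.mem_neighborSet, hadj]; grind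
    rw [this, Set.ncard_pair]; grind
  have hx : ((tree5 u v u' x y z).neighborSet x).ncard = 2 := by
    have : (tree5 u v u' x y z).neighborSet x = {u', z} := by
      ext r; simp only [SimpleGraph.mem_neighborSet, hadj]; grind
    rw [this, Set.ncard_pair]; grind
  have hy : ((tree5 u v u' x y z).neighborSet y).ncard = 1 := by
    have : (tree5 u v u' x y z).neighborSet y = {u'} := by
      ext r; simp only [SimpleGraph.mem_neighborSet, hadj]; grind
    rw [this, Set.ncard_singleton]
  have hv : ((tree5 u v u' x y z).neighborSet v).ncard = 1 := by
    have : (tree5 u v u' x y z).neighborSet v = {u} := by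
      ext r; simp only [SimpleGraph.mem_neighborSet, hadj]; grind
    rw [this, Set.ncard_singleton]
  have hz : ((tree5 u v u' x y z).neighborSet z).ncard = 1 := by
    have : (tree5 u v u' x y z).neighborSet z = {x} := by
      ext r; simp only [SimpleGraph.mem_neighborSet, hadj]; grind
    rw [this, Set.ncard_singleton]
  intro a b hab
  rw [hadj] at hab
  rcases hab with ⟨rfl, rfl | rfl | rfl⟩ | ⟨rfl, rfl | rfl⟩ | ⟨rfl, rfl | rfl⟩ | ⟨rfl, rfl⟩ | ⟨rfl, rfl⟩ |
    ⟨rfl, rfl⟩ <;> simp only [*] <;> decide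

theorem extB2 {V : Type*} (G : SimpleGraph V) (u v u' v' x y z w z' w' : V)
    (hu : ∀ r, G.Adj u r ↔ r = u' ∨ r = v) (hv : ∀ r, G.Adj v r → r = u ∨ r = v')
    (hu' : ∀ r, G.Adj u' r ↔ r = u ∨ r = x ∨ r = y) (hvu : u' ≠ v)
    (hxu : x ≠ u) (hyu : y ≠ u) (hxv : x ≠ v) (hyv : y ≠ v) (hxy : G.Adj x y)
    (hzu : z ≠ u') (hzy : z ≠ y) (hwu : w ≠ u') (hwx : w ≠ x)
    (hx : ∀ r, G.Adj x r ↔ r = u' ∨ r = y ∨ r = z)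
    (hy : ∀ r, G.Adj y r ↔ r = u' ∨ r = x ∨ r = w) (hzv : z ≠ v)
    (hz : ∀ r, (del G {u, u', x, y}).Adj z r → r = z')
    (hw : ∀ r, (del G {u, u', x, y}).Adj w r → r = w')
    (h : HasLIEC (del G {u, u', x, y}) 3) : HasLIEC G 3 := by
  obtain ⟨c, hc⟩ := h
  have n1 : u ≠ u' := ((hu u').2 (by simp)).ne
  have n2 : u ≠ v := ((hu v).2 (by simp)).ne
  have n3 : u' ≠ x := ((hu' x).2 (by simp)).ne
  have n4 : u' ≠ y := ((hu' y).2 (by simp)).ne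
  have n5 := hxy.ne
  have n6 : x ≠ z := ((hx z).2 (by simp)).ne
  have n7 : y ≠ w := ((hy w).2 (by simp)).ne
  have n8 : z ≠ u := by
    rintro rfl; have := ((hx z).2 (by simp)).symm; rw [hu] at this; grind
  have n9 : w ≠ u := by
    rintro rfl; have := ((hy w).2 (by simp)).symm; rw [hu] at this; grind
  have hs := fun a b : V => @SimpleGraph.Adj.symm V G a b
  have hadj := tree5_adj u v u' x y z (by simp; grind) n6.symm
  obtain ⟨i, hi1, hi2⟩ := fin3_avoid2 (c s(z, z')) (c s(v, v'))
  obtain ⟨j, hj1, hj2⟩ := fin3_avoid2 i (c s(w, w'))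
  obtain ⟨c1, hc1, e1, e1'⟩ := addPiece (del G {u, u', x, y} ⊔ tree5 u v u' x y z) _ 
    (tree5 u v u' x y z) c i hc
    (tree5_irr _ _ _ _ _ _ (by simp; grind)) (by simp)
    (by intro a b; simp only [hadj, del_adj, Set.mem_insert_iff,
          Set.mem_singleton_iff]; grind)
    (by
      intro p q r
      have := hz r
      simp only [hadj, del_adj, Set.mem_insert_iff,
          Set.mem_singleton_iff] at *; grind)
  obtain ⟨c2, hc2, -, -⟩ := addPiece G _ (cherry y x w) c1 j hc1
    (cherry_irr _ _ _ n5.symm n7 hwx.symm) 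
    (by intro a b; simp only [SimpleGraph.sup_adj, hadj, 
          cherry_adj _ _ _ _ _ n5.symm n7, del_adj, Set.mem_insert_iff,
          Set.mem_singleton_iff]; grind)
    (by intro a b; simp only [SimpleGraph.sup_adj, hadj,
          cherry_adj _ _ _ _ _ n5.symm n7, del_adj, Set.mem_insert_iff,
          Set.mem_singleton_iff]; grind)
    (by
      intro p q r
      have := e1 p r
      have := e1' p r
      have := hw r
      simp only [SimpleGraph.sup_adj, hadj, 
          cherry_adj _ _ _ _ _ n5.symm n7, del_adj, Set.mem_insert_iff,
          Set.mem_singleton_iff] at *; grind)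
  exact ⟨c2, hc2⟩

theorem deg2_nbrs {V : Type*} {G : SimpleGraph V} {u v : V} (h : G.Adj u v)
    (h2 : (G.neighborSet u).ncard = 2) : ∃ u', u' ≠ v ∧ ∀ r, G.Adj u r ↔ r = u' ∨ r = v := by
  obtain ⟨a, b, hab, hN⟩ := Set.ncard_eq_two.1 h2
  have hr : ∀ r, G.Adj u r ↔ r = a ∨ r = b := by
    intro r
    have : r ∈ G.neighborSet u ↔ r ∈ ({a, b} : Set V) := by rw [hN]
    simpa using this
  rcases (hr v).1 h with rfl | rfl
  · exact ⟨b, hab.symm, fun r => by rw [hr]; tauto⟩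
  · exact ⟨a, hab, hr⟩

theorem deg3_nbrs {V : Type*} [Fintype V] {G : SimpleGraph V} (hdeg : MaxDegreeLE G 3) {p a b c : V}
    (ha : G.Adj p a) (hb : G.Adj p b) (hc : G.Adj p c) (hab : a ≠ b) (hac : a ≠ c) (hbc : b ≠ c) :
    ∀ r, G.Adj p r ↔ r = a ∨ r = b ∨ r = c := by
  have hsub : ({a, b, c} : Set V) ⊆ G.neighborSet p := by
    rintro r (rfl | rfl | rfl) <;> assumption
  have h3 : ({a, b, c} : Set V).ncard = 3 := Set.ncard_eq_three.2 ⟨a, b, c, hab, hac, hbc, rfl⟩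
  have := Set.eq_of_subset_of_ncard_le hsub (by rw [h3]; exact hdeg p) (Set.toFinite _)
  intro r
  have h : r ∈ G.neighborSet p ↔ r ∈ ({a, b, c} : Set V) := by rw [this]
  simpa using h

theorem deg3_cover {V : Type*} [Fintype V] {G : SimpleGraph V} (hdeg : MaxDegreeLE G 3) {p a b : V}
    (ha : G.Adj p a) (hb : G.Adj p b) (hab : a ≠ b) :
    ∃ c, ∀ r, G.Adj p r → r = a ∨ r = b ∨ r = c := by
  by_cases h : ∃ c, G.Adj p c ∧ a ≠ c ∧ b ≠ c
  · obtain ⟨c, hc, h1, h2⟩ := h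
    exact ⟨c, fun r hr => (deg3_nbrs hdeg ha hb hc hab h1 h2 r).1 hr⟩
  · refine ⟨a, fun r hr => ?_⟩
    by_contra hcon
    exact h ⟨r, hr, by tauto, by tauto⟩

theorem GoodO.restrict {V : Type*} {G : SimpleGraph V} {O : V → V → Prop} (h : GoodO G O) (S : Set V)
    (hS : ∀ a b, O a b → a ∈ S → b ∈ S) : GoodO (del G S) (fun a b => O a b ∧ a ∉ S ∧ b ∉ S) where
  adj a b hab := ⟨h.adj _ _ hab.1, hab.2⟩
  tot a b hab := (h.tot a b hab.1).imp (fun k => ⟨k, hab.2⟩) (fun k => ⟨k, hab.2.2, hab.2.1⟩)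
  asymm a b hab hba := h.asymm _ _ hab.1 hba.1
  two a b hab := by
    obtain ⟨a', h1, h2⟩ := h.two a b hab.1
    exact ⟨a', h1, h2, fun h3 => hab.2.2 (hS _ _ h2 h3), hab.2.2⟩

def flipO {V : Type*} (O : V → V → Prop) (F : Set (Sym2 V)) (a b : V) : Prop :=
  (O a b ∧ s(a, b) ∉ F) ∨ (O b a ∧ s(a, b) ∈ F)

theorem GoodO.flip {V : Type*} {G : SimpleGraph V} {O : V → V → Prop} (h : GoodO G O)
    (F : Set (Sym2 V))
    (hF : ∀ b, (∀ a, s(a, b) ∉ F) ∨ (∀ a, ¬ flipO O F a b) ∨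
      ∃ a1 a2, a1 ≠ a2 ∧ flipO O F a1 b ∧ flipO O F a2 b) : GoodO G (flipO O F) where
  adj a b hab := by
    rcases hab with h1 | h1
    · exact h.adj _ _ h1.1
    · exact (h.adj _ _ h1.1).symm
  tot a b hab := by
    have := h.tot a b hab
    have hs : s(b, a) = s(a, b) := Sym2.eq_swap
    simp only [flipO, hs]
    tauto
  asymm a b := by
    have := h.asymm a b
    have := h.asymm b a
    have hs : s(b, a) = s(a, b) := Sym2.eq_swap
    simp only [flipO, hs]
    tauto
  two a b hab := by
    rcases hF b with h1 | h1 | ⟨a1, a2, h1, h2, h3⟩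
    · rcases hab with h2 | h2
      · obtain ⟨a', k1, k2⟩ := h.two a b h2.1
        exact ⟨a', k1, Or.inl ⟨k2, h1 a'⟩⟩
      · exact absurd h2.2 (h1 a)
    · exact absurd hab (h1 a)
    · by_cases k : a1 = a
      · exact ⟨a2, fun k2 => h1 (k.trans k2.symm), h3⟩
      · exact ⟨a1, k, h2⟩

/-- Case (i): `x` has exactly the two in-neighbours `u'`, `y`. -/
theorem flip_i {V : Type*} {G : SimpleGraph V} {O : V → V → Prop} (h : GoodO G O)
    (u v u' x y w : V) (hu : ∀ r, G.Adj u r ↔ r = u' ∨ r = v)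
    (hu' : ∀ r, G.Adj u' r ↔ r = u ∨ r = x ∨ r = y)
    (hxu : x ≠ u) (hyu : y ≠ u) (hO : O v u) (o1 : O u' x) (o2 : O u' y) (o3 : O y x) (o4 : O w y)
    (hx : ∀ a, O a x → a = u' ∨ a = y) (hw : w ≠ u') :
    ∃ O', GoodO G O' ∧ O' v u ∧ O' x u' ∧ O' y u' := by
  have n1 := (h.adj _ _ o1).ne
  have n2 := (h.adj _ _ o2).ne
  have n3 := (h.adj _ _ o3).ne
  have n4 := (h.adj _ _ o4).ne
  have n5 := h.asymm _ _ o3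
  have n6 := h.asymm _ _ o1
  have n7 := h.asymm _ _ o2
  have n8 : u ≠ u' := ((hu u').2 (by simp)).ne
  have o5 : O u' u := by
    obtain ⟨a, k1, k2⟩ := h.two _ _ hO
    have := (hu a).1 (h.adj _ _ k2).symm
    grind
  have hw' : w ≠ x := by rintro rfl; exact n5 o4
  refine ⟨flipO O {s(u', x), s(u', y), s(x, y)}, h.flip _ ?_, ?_, ?_, ?_⟩
  · intro b
    simp only [flipO, Set.mem_insert_iff, Set.mem_singleton_iff, Sym2.eq_iff]
    by_cases hb : b = u'
    · subst hb; right; right; exact ⟨x, y, n3.symm, by grind, by grind⟩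
    by_cases hb : b = x
    · subst hb; right; left; grind
    by_cases hb : b = y
    · subst hb; right; right; exact ⟨x, w, hw'.symm, by grind, by grind⟩
    left; grind
  all_goals
    simp only [flipO, Set.mem_insert_iff, Set.mem_singleton_iff, Sym2.eq_iff]
    grind

/-- Case (ii): both other edges at `w` are centred at `w`. -/
theorem flip_ii {V : Type*} {G : SimpleGraph V} {O : V → V → Prop} (h : GoodO G O)
    (u v u' x y z w s t : V) 
    (hu' : ∀ r, G.Adj u' r ↔ r = u ∨ r = x ∨ r = y)
    (hxu : x ≠ u) (hyu : y ≠ u) (hwu : w ≠ u) (hO : O v u)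
    (o1 : O u' x) (o2 : O u' y) (o3 : O y x) (o4 : O w y) (o5 : O z x)
    (hy : ∀ r, G.Adj y r ↔ r = u' ∨ r = x ∨ r = w)
    (hw : w ≠ u') (hwx : w ≠ x) (hzu : z ≠ u') (hzy : z ≠ y) (o6 : O s w)
    (hsu : u ≠ u') (hsy : s ≠ y) :
    ∃ O', GoodO G O' ∧ O' v u ∧ O' x u' ∧ O' y u' := by
  have n1 := (h.adj _ _ o1).ne
  have n2 := (h.adj _ _ o2).ne
  have n3 := (h.adj _ _ o3).ne
  have n4 := (h.adj _ _ o4).ne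
  have n9 := (h.adj _ _ o6).ne
  have n5 := h.asymm _ _ o3
  have n6 := h.asymm _ _ o1
  have n7 := h.asymm _ _ o2
  have n15 := h.asymm _ _ o4
  have hya := fun a (k : O a y) => (hy a).1 (h.adj _ _ k).symm
  refine ⟨flipO O {s(u', x), s(u', y), s(y, w)}, h.flip _ ?_, ?_, ?_, ?_⟩
  · intro b
    simp only [flipO, Set.mem_insert_iff, Set.mem_singleton_iff, Sym2.eq_iff]
    by_cases hb : b = u'
    · subst hb; right; right; exact ⟨x, y, n3.symm, by grind, by grind⟩
    by_cases hb : b = x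
    · subst hb; right; right; exact ⟨y, z, hzy.symm, by grind, by grind⟩
    by_cases hb : b = y
    · subst hb; right; left; grind
    by_cases hb : b = w
    · subst hb; right; right; exact ⟨y, s, hsy.symm, by grind, by grind⟩
    left; grind
  all_goals
    simp only [flipO, Set.mem_insert_iff, Set.mem_singleton_iff, Sym2.eq_iff]
    grind

/-- Cases (iii), (iv): the other edges at `w` are centred at `s` and `t`. -/
theorem flip_iii {V : Type*} {G : SimpleGraph V} {O : V → V → Prop} (h : GoodO G O)
    (u v u' x y z w s t : V) 
    (hxu : x ≠ u) (hyu : y ≠ u) (hwu : w ≠ u) (hO : O v u)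
    (o1 : O u' x) (o2 : O u' y) (o3 : O y x) (o4 : O w y) (o5 : O z x)
    (hy : ∀ r, G.Adj y r ↔ r = u' ∨ r = x ∨ r = w)
    (hw : w ≠ u') (hwx : w ≠ x) (hzu : z ≠ u') (hzy : z ≠ y) 
    (hsu : u ≠ u') (hsy : s ≠ y) (hty : t ≠ y) (hsx : s ≠ x) (htx : t ≠ x) (hsu' : s ≠ u')
    (htu' : t ≠ u') (hs : s ≠ u) (ht : t ≠ u) (o6 : O w s) (o7 : O w t) (o8 : O t s) :
    ∃ O', GoodO G O' ∧ O' v u ∧ O' x u' ∧ O' y u' := by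
  have n1 := (h.adj _ _ o1).ne
  have n2 := (h.adj _ _ o2).ne
  have n3 := (h.adj _ _ o3).ne
  have n4 := (h.adj _ _ o4).ne
  have n9 := (h.adj _ _ o6).ne
  have n10 := (h.adj _ _ o7).ne
  have n11 := (h.adj _ _ o8).ne
  have n5 := h.asymm _ _ o3
  have n6 := h.asymm _ _ o1
  have n7 := h.asymm _ _ o2
  have n12 := h.asymm _ _ o6
  have n13 := h.asymm _ _ o7
  have n14 := h.asymm _ _ o8
  have n15 := h.asymm _ _ o4
  have hya := fun a (k : O a y) => (hy a).1 (h.adj _ _ k).symm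
  obtain ⟨t', m1, m2⟩ := h.two _ _ o7
  have m3 : t' ≠ s := by rintro rfl; exact n14 m2
  by_cases hthird : ∃ s', O s' s ∧ s' ≠ w ∧ s' ≠ t
  · obtain ⟨s', q1, q2, q3⟩ := hthird
    clear hy
    refine ⟨flipO O {s(u', x), s(u', y), s(y, w), s(w, t), s(t, s)}, h.flip _ ?_, ?_, ?_, ?_⟩
    · intro b
      simp only [flipO, Set.mem_insert_iff, Set.mem_singleton_iff, Sym2.eq_iff]
      by_cases hb : b = u'
      · subst hb; right; right; exact ⟨x, y, n3.symm, by grind, by grind⟩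
      by_cases hb : b = x
      · subst hb; right; right; exact ⟨y, z, hzy.symm, by grind, by grind⟩
      by_cases hb : b = y
      · subst hb; right; left; grind
      by_cases hb : b = w
      · subst hb; right; right; exact ⟨y, t, hty.symm, by grind, by grind⟩
      by_cases hb : b = s
      · subst hb; right; right; exact ⟨w, s', q2.symm, by grind, by grind⟩
      by_cases hb : b = t
      · subst hb; right; right; exact ⟨s, t', m3.symm, by grind, by grind⟩
      left; grind
    all_goals
      simp only [flipO, Set.mem_insert_iff, Set.mem_singleton_iff, Sym2.eq_iff]
      grind
  · have hsa : ∀ a, O a s → a = w ∨ a = t := by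
      intro a ha; by_contra hcon; exact hthird ⟨a, ha, by tauto, by tauto⟩
    clear hy hthird
    refine ⟨flipO O {s(u', x), s(u', y), s(y, w), s(w, s), s(w, t), s(t, s)}, h.flip _ ?_, ?_, ?_, ?_⟩
    · intro b
      simp only [flipO, Set.mem_insert_iff, Set.mem_singleton_iff, Sym2.eq_iff]
      by_cases hb : b = u'
      · subst hb; right; right; exact ⟨x, y, n3.symm, by grind, by grind⟩
      by_cases hb : b = x
      · subst hb; right; right; exact ⟨y, z, hzy.symm, by grind, by grind⟩
      by_cases hb : b = y
      · subst hb; right; left; grind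
      by_cases hb : b = w
      · subst hb; right; right; exact ⟨y, t, hty.symm, by grind, by grind⟩
      by_cases hb : b = s
      · subst hb; right; left; grind
      by_cases hb : b = t
      · subst hb; right; right; exact ⟨s, t', m3.symm, by grind, by grind⟩
      left; grind
    all_goals
      simp only [flipO, Set.mem_insert_iff, Set.mem_singleton_iff, Sym2.eq_iff]
      grind

theorem flip_w {V : Type*} [Fintype V] {G : SimpleGraph V} {O : V → V → Prop} (h : GoodO G O)
    (hclaw : ClawFree G) (hdeg : MaxDegreeLE G 3)
    (u v u' v' x y z w s t : V) (hu : ∀ r, G.Adj u r ↔ r = u' ∨ r = v)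
    (hv : ∀ r, G.Adj v r → r = u ∨ r = v')
    (hu' : ∀ r, G.Adj u' r ↔ r = u ∨ r = x ∨ r = y)
    (hxu : x ≠ u) (hyu : y ≠ u) (hyv : y ≠ v) (hO : O v u)
    (o1 : O u' x) (o2 : O u' y) (o3 : O y x) (o4 : O w y) (o5 : O z x)
    (hy : ∀ r, G.Adj y r ↔ r = u' ∨ r = x ∨ r = w)
    (hw : w ≠ u') (hwx : w ≠ x) (hzu : z ≠ u') (hzy : z ≠ y) (hst : s ≠ t)
    (hs : (del G {u, u', x, y}).Adj w s) (ht : (del G {u, u', x, y}).Adj w t) :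
    ∃ O', GoodO G O' ∧ O' v u ∧ O' x u' ∧ O' y u' := by
  simp only [del_adj, Set.mem_insert_iff, Set.mem_singleton_iff] at hs ht
  obtain ⟨hs, hs1, hs2⟩ := hs
  obtain ⟨ht, ht1, ht2⟩ := ht
  push Not at hs1 hs2 ht1 ht2
  have hsu : u ≠ u' := ((hu u').2 (by simp)).ne
  have n4 := (h.adj _ _ o4).ne
  have hwy := h.adj _ _ o4
  have hNw := deg3_nbrs hdeg hwy hs ht hs2.2.2.2.symm ht2.2.2.2.symm hst
  have hwv : w ≠ v := by
    rintro rfl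
    have := hv s hs
    have := hv t ht
    grind
  have hadj : G.Adj s t := by
    by_contra hcon
    refine hclaw ⟨w, y, s, t, hs2.2.2.2.symm, ht2.2.2.2.symm, hst, hwy, hs, ht, ?_, ?_, hcon⟩
    · intro k; have := (hy s).1 k; have := hs.ne; grind
    · intro k; have := (hy t).1 k; have := ht.ne; grind
  by_cases k1 : O s w
  · exact flip_ii h u v u' x y z w s t hu' hxu hyu hs1.1 hO o1 o2 o3 o4 o5 hy hw hwx hzu hzy k1 hsu
      hs2.2.2.2
  by_cases k2 : O t w
  · exact flip_ii h u v u' x y z w t s hu' hxu hyu hs1.1 hO o1 o2 o3 o4 o5 hy hw hwx hzu hzy k2 hsu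
      ht2.2.2.2
  have o6 : O w s := (h.tot _ _ hs).resolve_right k1
  have o7 : O w t := (h.tot _ _ ht).resolve_right k2
  rcases h.tot _ _ hadj with k | k
  · exact flip_iii h u v u' x y z w t s hxu hyu hs1.1 hO o1 o2 o3 o4 o5 hy hw hwx hzu hzy hsu
      ht2.2.2.2 hs2.2.2.2 ht2.2.2.1 hs2.2.2.1 ht2.2.1 hs2.2.1 ht2.1 hs2.1 o7 o6 k
  · exact flip_iii h u v u' x y z w s t hxu hyu hs1.1 hO o1 o2 o3 o4 o5 hy hw hwx hzu hzy hsu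
      hs2.2.2.2 ht2.2.2.2 hs2.2.2.1 ht2.2.2.1 hs2.2.1 ht2.2.1 hs2.1 ht2.1 o6 o7 k

theorem b1fin {V : Type*} [Fintype V] {G : SimpleGraph V} {O : V → V → Prop} (h : GoodO G O)
    (hclaw : ClawFree G) (hdeg : MaxDegreeLE G 3)
    (hmin : ∀ (W : Type) [Fintype W] (H : SimpleGraph W),
      Decomposable H → ClawFree H → MaxDegreeLE H 3 →
      H.edgeSet.ncard < G.edgeSet.ncard → HasLIEC H 3)
    (u v u' v' x y : V) (hu : ∀ r, G.Adj u r ↔ r = u' ∨ r = v)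
    (hv : ∀ r, G.Adj v r → r = u ∨ r = v')
    (hu' : ∀ r, G.Adj u' r ↔ r = u ∨ r = x ∨ r = y) (hvu : u' ≠ v)
    (hxu : x ≠ u) (hyu : y ≠ u) (hxv : x ≠ v) (hyv : y ≠ v) (hxy : G.Adj x y)
    (o1 : O v u) (o2 : O x u') (o3 : O y u') : HasLIEC G 3 := by
  have a1 := h.asymm _ _ o1
  have a2 := h.asymm _ _ o2
  have a3 := h.asymm _ _ o3
  have hxu' := h.adj _ _ o2
  have hyu' := h.adj _ _ o3
  obtain ⟨z, hz⟩ := deg3_cover hdeg hxu' hxy hyu'.ne.symm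
  obtain ⟨w, hw⟩ := deg3_cover hdeg hyu' hxy.symm hxu'.ne.symm
  refine extB1 G u v u' v' x y z w hu hv hu' hvu hxu hyu hxv hyv hxy hz hw ?_
  refine del_liec G hclaw hdeg hmin {u, u'} u u' ((hu u').2 (by simp)) (by simp) _
    (h.restrict {u, u'} ?_)
  intro a b hab ha
  have hadj := h.adj _ _ hab
  simp only [Set.mem_insert_iff, Set.mem_singleton_iff] at ha ⊢
  rcases ha with rfl | rfl
  · rcases (hu b).1 hadj with rfl | rfl
    · right; rfl
    · exact absurd hab a1
  · rcases (hu' b).1 hadj with rfl | rfl | rfl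
    · left; rfl
    · exact absurd hab a2
    · exact absurd hab a3

theorem core3 {V : Type*} [Fintype V] {G : SimpleGraph V} {O : V → V → Prop} (h : GoodO G O)
    (hclaw : ClawFree G) (hdeg : MaxDegreeLE G 3)
    (hmin : ∀ (W : Type) [Fintype W] (H : SimpleGraph W),
      Decomposable H → ClawFree H → MaxDegreeLE H 3 →
      H.edgeSet.ncard < G.edgeSet.ncard → HasLIEC H 3)
    (u v u' v' x y : V) (hu : ∀ r, G.Adj u r ↔ r = u' ∨ r = v)
    (hv : ∀ r, G.Adj v r → r = u ∨ r = v')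
    (hu' : ∀ r, G.Adj u' r ↔ r = u ∨ r = x ∨ r = y) (hvu : u' ≠ v)
    (hxu : x ≠ u) (hyu : y ≠ u) (hxv : x ≠ v) (hyv : y ≠ v)
    (hO : O v u) (o1 : O u' x) (o2 : O u' y) (o3 : O y x) : HasLIEC G 3 := by
  have hyx := h.adj _ _ o3
  have a1 := h.asymm _ _ hO
  have a2 := h.asymm _ _ o1
  have a3 := h.asymm _ _ o2
  have a4 := h.asymm _ _ o3
  have hux := h.adj _ _ o1
  have huy := h.adj _ _ o2
  have fin : ∀ O', GoodO G O' ∧ O' v u ∧ O' x u' ∧ O' y u' → HasLIEC G 3 := fun O' k =>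
    b1fin k.1 hclaw hdeg hmin u v u' v' x y hu hv hu' hvu hxu hyu hxv hyv hyx.symm k.2.1 k.2.2.1
      k.2.2.2
  obtain ⟨w, hwu, o4⟩ := h.two _ _ o2
  have hwx : w ≠ x := by rintro rfl; exact a4 o4
  by_cases hz : ∃ z, O z x ∧ z ≠ u' ∧ z ≠ y
  swap
  · obtain ⟨O', k⟩ := flip_i h u v u' x y w hu hu' hxu hyu hO o1 o2 o3 o4
      (fun a ha => by by_contra hc; exact hz ⟨a, ha, by tauto, by tauto⟩) hwu
    exact fin O' k
  obtain ⟨z, o5, hzu, hzy⟩ := hz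
  have hzx := h.adj _ _ o5
  have hwy := h.adj _ _ o4
  have hx := deg3_nbrs hdeg hux.symm hyx.symm hzx.symm huy.ne hzu.symm hzy.symm
  have hy := deg3_nbrs hdeg huy.symm hyx hwy.symm hux.ne hwu.symm hwx.symm
  by_cases hw : ∃ w', ∀ r, (del G {u, u', x, y}).Adj w r → r = w'
  swap
  · have : ∃ s t, s ≠ t ∧ (del G {u, u', x, y}).Adj w s ∧ (del G {u, u', x, y}).Adj w t := by
      push Not at hw
      obtain ⟨s, hs, _⟩ := hw u
      obtain ⟨t, ht, hts⟩ := hw s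
      exact ⟨s, t, hts.symm, hs, ht⟩
    obtain ⟨s, t, hst, hs, ht⟩ := this
    obtain ⟨O', k⟩ := flip_w h hclaw hdeg u v u' v' x y z w s t hu hv hu' hxu hyu hyv hO o1 o2 o3 o4
      o5 hy hwu hwx hzu hzy hst hs ht
    exact fin O' k
  have hset : ({u, u', y, x} : Set V) = {u, u', x, y} := by
    ext r; simp only [Set.mem_insert_iff, Set.mem_singleton_iff]; tauto
  have hu2 : ∀ r, G.Adj u' r ↔ r = u ∨ r = y ∨ r = x := fun r => by rw [hu']; tauto
  by_cases hz : ∃ z', ∀ r, (del G {u, u', x, y}).Adj z r → r = z'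
  swap
  · have : ∃ s t, s ≠ t ∧ (del G {u, u', x, y}).Adj z s ∧ (del G {u, u', x, y}).Adj z t := by
      push Not at hz
      obtain ⟨s, hs, _⟩ := hz u
      obtain ⟨t, ht, hts⟩ := hz s
      exact ⟨s, t, hts.symm, hs, ht⟩
    obtain ⟨s, t, hst, hs, ht⟩ := this
    have n1 := hux.ne
    have n2 := huy.ne
    have n3 := hyx.ne
    have n4 := hzx.ne
    have n5 := hwy.ne
    have hg : GoodO G (flipO O {s(x, y)}) := by
      refine h.flip _ ?_
      intro b
      simp only [flipO, Set.mem_singleton_iff, Sym2.eq_iff]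
      by_cases hb : b = x
      · subst hb; right; right; exact ⟨u', z, hzu.symm, by grind, by grind⟩
      by_cases hb : b = y
      · subst hb; right; right; exact ⟨u', w, hwu.symm, by grind, by grind⟩
      left; grind
    obtain ⟨O', k⟩ := flip_w hg hclaw hdeg u v u' v' y x w z s t hu hv hu2 hyu hxu hxv
      (by simp only [flipO, Set.mem_singleton_iff, Sym2.eq_iff]; grind)
      (by simp only [flipO, Set.mem_singleton_iff, Sym2.eq_iff]; grind)
      (by simp only [flipO, Set.mem_singleton_iff, Sym2.eq_iff]; grind)
      (by simp only [flipO, Set.mem_singleton_iff, Sym2.eq_iff]; grind)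
      (by simp only [flipO, Set.mem_singleton_iff, Sym2.eq_iff]; grind)
      (by simp only [flipO, Set.mem_singleton_iff, Sym2.eq_iff]; grind)
      hx hzu hzy hwu hwx hst (by rw [hset]; exact hs) (by rw [hset]; exact ht)
    exact fin O' ⟨k.1, k.2.1, k.2.2.2, k.2.2.1⟩
  obtain ⟨w', hw⟩ := hw
  obtain ⟨z', hz⟩ := hz
  have hH : HasLIEC (del G {u, u', x, y}) 3 := by
    refine del_liec G hclaw hdeg hmin {u, u', x, y} u u' ((hu u').2 (by simp)) (by simp) _
      (h.restrict {u, u', x, y} ?_)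
    intro a b hab ha
    have hadj := h.adj _ _ hab
    have a5 := h.asymm _ _ o4
    have a6 := h.asymm _ _ o5
    simp only [Set.mem_insert_iff, Set.mem_singleton_iff] at ha ⊢
    rcases ha with rfl | rfl | rfl | rfl
    · have := (hu b).1 hadj; grind
    · have := (hu' b).1 hadj; grind
    · have := (hx b).1 hadj; grind
    · have := (hy b).1 hadj; grind
  by_cases hzv : z = v
  · have hwv : w ≠ v := by
      rintro rfl
      subst hzv
      have h1 := hv _ hzx
      have h2 := hv _ hwy
      have := hyx.ne
      grind
    exact extB2 G u v u' v' y x w z w' z' hu hv hu2 hvu hyu hxu hyv hxv hyx hwu hwx hzu hzy hy hx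
      hwv (by rw [hset]; exact hw) (by rw [hset]; exact hz) (by rw [hset]; exact hH)
  · exact extB2 G u v u' v' x y z w z' w' hu hv hu' hvu hxu hyu hxv hyv hyx.symm hzu hzy hwu hwx
      hx hy hzv hz hw hH

theorem core {V : Type*} [Fintype V] {G : SimpleGraph V} {O : V → V → Prop} (h : GoodO G O)
    (hclaw : ClawFree G) (hdeg : MaxDegreeLE G 3)
    (hmin : ∀ (W : Type) [Fintype W] (H : SimpleGraph W),
      Decomposable H → ClawFree H → MaxDegreeLE H 3 →
      H.edgeSet.ncard < G.edgeSet.ncard → HasLIEC H 3)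
    (u v : V) (d1 : (G.neighborSet u).ncard = 2) (d2 : (G.neighborSet v).ncard = 2)
    (hO : O v u) : HasLIEC G 3 := by
  have hvu := h.adj _ _ hO
  have a1 := h.asymm _ _ hO
  obtain ⟨u', nu, hu⟩ := deg2_nbrs hvu.symm d1
  obtain ⟨v', nv, hv⟩ := deg2_nbrs hvu d2
  have huu' : G.Adj u u' := (hu u').2 (by simp)
  have hvv' : G.Adj v v' := (hv v').2 (by simp)
  have o1 : O u' u := by
    obtain ⟨a, k1, k2⟩ := h.two _ _ hO
    rcases (hu a).1 (h.adj _ _ k2).symm with rfl | rfl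
    · exact k2
    · exact absurd rfl k1
  have o2 : O v v' := by
    refine (h.tot _ _ hvv').resolve_right fun k => ?_
    obtain ⟨a, k1, k2⟩ := h.two _ _ k
    rcases (hv a).1 (h.adj _ _ k2).symm with rfl | rfl
    · exact k1 rfl
    · exact a1 k2
  have hv2 : ∀ r, G.Adj v r ↔ r = u ∨ r = v' := fun r => by rw [hv]; tauto
  have a2 := h.asymm _ _ o2
  by_cases hA : v' = u'
  · subst hA
    obtain ⟨t, k1, k2⟩ := h.two _ _ o2
    have a3 := h.asymm _ _ k2
    have ntu : t ≠ u := by rintro rfl; exact h.asymm _ _ o1 k2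
    have hu' := deg3_nbrs hdeg huu'.symm hvv'.symm (h.adj _ _ k2).symm hvu.ne.symm ntu.symm k1.symm
    have htv := h.adj _ _ k2
    have : ∃ q1 q2, ∀ r, G.Adj t r → r ≠ v' → r = q1 ∨ r = q2 := by
      by_cases hq : ∃ q, G.Adj t q ∧ v' ≠ q
      · obtain ⟨q, hq, hq2⟩ := hq
        obtain ⟨c, hc⟩ := deg3_cover hdeg htv hq hq2
        exact ⟨q, c, fun r hr hr2 => (hc r hr).resolve_left hr2⟩
      · exact ⟨u, u, fun r hr hr2 => absurd ⟨r, hr, hr2.symm⟩ hq⟩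
    obtain ⟨q1, q2, hq⟩ := this
    refine extA G u v v' t q1 q2 hu hv2 hu' ntu k1 ?_ ?_
    · intro r hr
      rw [del_adj] at hr
      exact hq r hr.1 (fun e => hr.2.2 (by simp [e]))
    · refine del_liec G hclaw hdeg hmin {u, v'} u v' huu' (by simp) _ (h.restrict {u, v'} ?_)
      intro a b hab ha
      have hadj := h.adj _ _ hab
      simp only [Set.mem_insert_iff, Set.mem_singleton_iff] at ha ⊢
      rcases ha with rfl | rfl
      · have := (hu b).1 hadj; grind
      · have := (hu' b).1 hadj; grind
  have hv3 : ∀ r, G.Adj v r → r = u ∨ r = v' := fun r => (hv2 r).1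
  have nvu' : ¬ G.Adj v u' := by
    intro k
    rcases (hv u').1 k with k | k
    · exact hA k.symm
    · exact huu'.ne k.symm
  by_cases hxy : ∃ x y, x ≠ y ∧ x ≠ u ∧ y ≠ u ∧ G.Adj u' x ∧ G.Adj u' y
  swap
  · have : ∃ q, ∀ r, G.Adj u' r → r = u ∨ r = q := by
      by_cases hq : ∃ q, G.Adj u' q ∧ q ≠ u
      · obtain ⟨q, hq1, hq2⟩ := hq
        refine ⟨q, fun r hr => ?_⟩
        by_contra hcon
        exact hxy ⟨r, q, by tauto, by tauto, hq2, hr, hq1⟩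
      · exact ⟨u, fun r hr => by by_contra hcon; exact hq ⟨r, hr, by tauto⟩⟩
    obtain ⟨q, hq⟩ := this
    refine extB0 G u v u' v' q hu hv3 hq nu ?_
    refine del_liec G hclaw hdeg hmin {u} u u' huu' (by simp) _ (h.restrict {u} ?_)
    intro a b hab ha
    have hadj := h.adj _ _ hab
    have := h.asymm _ _ o1
    simp only [Set.mem_singleton_iff] at ha ⊢
    subst ha
    have := (hu b).1 hadj
    grind
  obtain ⟨x, y, nxy, nxu, nyu, hx, hy⟩ := hxy
  have hu' := deg3_nbrs hdeg huu'.symm hx hy nxu.symm nyu.symm nxy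
  have hu2 : ∀ r, G.Adj u' r ↔ r = u ∨ r = y ∨ r = x := fun r => by rw [hu']; tauto
  have nxv : x ≠ v := by rintro rfl; exact nvu' hx.symm
  have nyv : y ≠ v := by rintro rfl; exact nvu' hy.symm
  have hadj : G.Adj x y := by
    by_contra hcon
    refine hclaw ⟨u', u, x, y, nxu.symm, nyu.symm, nxy, huu'.symm, hx, hy, ?_, ?_, hcon⟩
    · intro k; have := (hu x).1 k; have := hx.ne; grind
    · intro k; have := (hu y).1 k; have := hy.ne; grind
  have a3 := h.asymm _ _ o1
  by_cases k1 : O x u'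
  · obtain ⟨a, m1, m2⟩ := h.two _ _ k1
    have k2 : O y u' := by
      have := (hu' a).1 (h.adj _ _ m2).symm
      grind
    exact b1fin h hclaw hdeg hmin u v u' v' x y hu hv3 hu' nu nxu nyu nxv nyv hadj hO k1 k2
  by_cases k2 : O y u'
  · obtain ⟨a, m1, m2⟩ := h.two _ _ k2
    exfalso
    have := (hu' a).1 (h.adj _ _ m2).symm
    grind
  have p1 := (h.tot _ _ hx).resolve_right k1
  have p2 := (h.tot _ _ hy).resolve_right k2
  rcases h.tot _ _ hadj with k | k
  · exact core3 h hclaw hdeg hmin u v u' v' y x hu hv3 hu2 nu nyu nxu nyv nxv hO p2 p1 k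
  · exact core3 h hclaw hdeg hmin u v u' v' x y hu hv3 hu' nu nxu nyu nxv nyv hO p1 p2 k

/-- In a minimal counterexample to the 3-color theorem for claw-free subcubic graphs, no two adjacent vertices both have degree 2. -/
theorem minimal_cex_no_adjacent_deg2 {V : Type*} [Fintype V] (G : SimpleGraph V)
    (hconn : G.Connected) (hdec : Decomposable G) (hclaw : ClawFree G)
    (hdeg : MaxDegreeLE G 3) (hG : ¬ HasLIEC G 3)
    (hmin : ∀ (W : Type) [Fintype W] (H : SimpleGraph W),
      Decomposable H → ClawFree H → MaxDegreeLE H 3 →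
      H.edgeSet.ncard < G.edgeSet.ncard → HasLIEC H 3) :
    ¬ ∃ u v : V, G.Adj u v ∧ (G.neighborSet u).ncard = 2 ∧ (G.neighborSet v).ncard = 2 := by
  rintro ⟨u, v, huv, h1, h2⟩
  obtain ⟨O, hO⟩ := exists_good G hdec hclaw hdeg
  rcases hO.tot _ _ huv with k | k
  · exact hG (core hO hclaw hdeg hmin v u h2 h1 k)
  · exact hG (core hO hclaw hdeg hmin u v h1 h2 k)
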